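/- Consider the K-receiver DM BC with messages M_{\overline{K}} (desired by receivers 1..K−1) and M_{\overline{K−1}} (desired by receivers 1..K−2 and K), for the class of channels where Y_i is less noisy than Y_K for all i ∈ [1:K−1]. Then the converse holds: every achievable rate pair satisfies R_{\overline{K−1}} ≤ I(U;Y_K) and R_{\overline{K−1}} + R_{\overline{K}} ≤ I(X;Y_j | U) + I(U;Y_K) for all j ∈ [1:K−1], for some joint distribution p(u,x) with U ⊸ X ⊸ (Y_1,...,Y_K). The identification U_i = (M_{\overline{K−1}}, Y_K^{i−1}) together with the less-noisy information inequality I(Y_j^{i−1}; Y_{j,i} | M_{\overline{K−1}}) ≥ I(Y_K^{i−1}; Y_{j,i} | M_{\overline{K−1}}) yields the single-letter bound. -/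

import Mathlib

open Finset

/-- Shannon entropy (in bits) of the random variable `X` on the finite probability
space `(Ω, p)`, with the convention `0 · log 0 = 0`. -/
noncomputable def ent {Ω α : Type*} [Fintype Ω] [Fintype α] [DecidableEq α]
    (p : Ω → ℝ) (X : Ω → α) : ℝ :=
  -∑ x : α, (∑ ω ∈ univ.filter (fun ω => X ω = x), p ω) *
      Real.logb 2 (∑ ω ∈ univ.filter (fun ω => X ω = x), p ω)

/-- Mutual information `I(X;Y) = H(X) + H(Y) − H(X,Y)` (in bits). -/
noncomputable def mutInf {Ω α β : Type*} [Fintype Ω] [Fintype α] [DecidableEq α]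
    [Fintype β] [DecidableEq β] (p : Ω → ℝ) (X : Ω → α) (Y : Ω → β) : ℝ :=
  ent p X + ent p Y - ent p (fun ω => (X ω, Y ω))

/-- Conditional mutual information
`I(X;Y|Z) = H(X,Z) + H(Y,Z) − H(X,Y,Z) − H(Z)` (in bits). -/
noncomputable def condMutInf {Ω α β γ : Type*} [Fintype Ω] [Fintype α] [DecidableEq α]
    [Fintype β] [DecidableEq β] [Fintype γ] [DecidableEq γ]
    (p : Ω → ℝ) (X : Ω → α) (Y : Ω → β) (Z : Ω → γ) : ℝ :=
  ent p (fun ω => (X ω, Z ω)) + ent p (fun ω => (Y ω, Z ω))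
    - ent p (fun ω => (X ω, Y ω, Z ω)) - ent p Z

/-- `p` is a probability mass function on the finite sample space `Ω`. -/
def IsProb {Ω : Type*} [Fintype Ω] (p : Ω → ℝ) : Prop :=
  (∀ ω, 0 ≤ p ω) ∧ ∑ ω, p ω = 1

/-- The law of the random variable `X` on the finite space `(Ω, p)`. -/
def rvLaw {Ω α : Type*} [Fintype Ω] [DecidableEq α] (p : Ω → ℝ) (X : Ω → α) (a : α) : ℝ :=
  ∑ ω ∈ univ.filter (fun ω => X ω = a), p ω

/-- Shannon entropy in nats. -/
noncomputable def natEnt {Ω α : Type*} [Fintype Ω] [Fintype α] [DecidableEq α]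
    (p : Ω → ℝ) (X : Ω → α) : ℝ :=
  ∑ a, Real.negMulLog (rvLaw p X a)

section Entropy

variable {Ω α β : Type*} [Fintype Ω] [Fintype α] [DecidableEq α] [Fintype β] [DecidableEq β]
  {p : Ω → ℝ}

theorem ent_eq_natEnt_div (p : Ω → ℝ) (X : Ω → α) : ent p X = natEnt p X / Real.log 2 := by
  unfold ent natEnt rvLaw Real.negMulLog Real.logb
  rw [← Finset.sum_neg_distrib, Finset.sum_div]
  refine Finset.sum_congr rfl fun a _ => ?_
  ring

theorem sum_rvLaw_mul (p : Ω → ℝ) (X : Ω → α) (g : α → ℝ) :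
    ∑ a, rvLaw p X a * g a = ∑ ω, p ω * g (X ω) := by
  rw [← Finset.sum_fiberwise univ X (fun ω => p ω * g (X ω))]
  refine Finset.sum_congr rfl fun a _ => ?_
  rw [rvLaw, Finset.sum_mul]
  refine Finset.sum_congr rfl fun ω hω => ?_
  rw [(Finset.mem_filter.1 hω).2]

theorem sum_rvLaw (p : Ω → ℝ) (X : Ω → α) : ∑ a, rvLaw p X a = ∑ ω, p ω := by
  simpa using sum_rvLaw_mul p X (fun _ => 1)

omit [Fintype α] in
theorem rvLaw_nonneg (hp : ∀ ω, 0 ≤ p ω) (X : Ω → α) (a : α) : 0 ≤ rvLaw p X a :=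
  Finset.sum_nonneg fun ω _ => hp ω

omit [Fintype α] in
theorem le_rvLaw (hp : ∀ ω, 0 ≤ p ω) (X : Ω → α) (ω : Ω) : p ω ≤ rvLaw p X (X ω) :=
  Finset.single_le_sum (f := p) (fun i _ => hp i) (by simp)

omit [Fintype α] in
theorem rvLaw_prodMk_sum (p : Ω → ℝ) (X : Ω → α) (Y : Ω → β) (a : α) :
    ∑ b, rvLaw p (fun ω => (X ω, Y ω)) (a, b) = rvLaw p X a := by
  unfold rvLaw
  rw [← Finset.sum_fiberwise (univ.filter fun ω => X ω = a) Y p]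
  refine Finset.sum_congr rfl fun b _ => ?_
  rw [Finset.filter_filter]
  simp only [Prod.mk.injEq]

theorem natEnt_eq_sum (p : Ω → ℝ) (X : Ω → α) :
    natEnt p X = -∑ ω, p ω * Real.log (rvLaw p X (X ω)) := by
  rw [← sum_rvLaw_mul p X (fun a => Real.log (rvLaw p X a)), ← Finset.sum_neg_distrib]
  simp [natEnt, Real.negMulLog]

theorem natEnt_congr (p : Ω → ℝ) {X : Ω → α} {Y : Ω → β}
    (h : ∀ ω ω', X ω = X ω' ↔ Y ω = Y ω') : natEnt p X = natEnt p Y := by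
  simp only [natEnt_eq_sum, rvLaw, h]

/-- Gibbs' inequality. -/
theorem natEnt_le (hp : IsProb p) (X : Ω → α) (q : α → ℝ) (hq : ∀ a, 0 ≤ q a)
    (hq1 : ∑ a, q a ≤ 1) (hpq : ∀ ω, 0 < p ω → 0 < q (X ω)) :
    natEnt p X ≤ -∑ ω, p ω * Real.log (q (X ω)) := by
  rw [← sum_rvLaw_mul p X (fun a => Real.log (q a)), ← Finset.sum_neg_distrib]
  have key : ∀ a, Real.negMulLog (rvLaw p X a) ≤
      -(rvLaw p X a * Real.log (q a)) + (q a - rvLaw p X a) := by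
    intro a
    rcases (rvLaw_nonneg hp.1 X a).eq_or_lt with h0 | h0
    · rw [← h0]; simpa using hq a
    · obtain ⟨ω, hω, hω'⟩ : ∃ ω ∈ univ.filter (fun ω => X ω = a), 0 < p ω := by
        by_contra! hc
        exact absurd h0 (not_lt.2 (Finset.sum_nonpos hc))
      have hqa : 0 < q a := by
        have := hpq ω hω'
        rwa [(Finset.mem_filter.1 hω).2] at this
      have h1 := Real.log_le_sub_one_of_pos (div_pos hqa h0)
      rw [Real.log_div hqa.ne' h0.ne'] at h1
      have h2 := mul_le_mul_of_nonneg_left h1 h0.le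
      have h3 : rvLaw p X a * (q a / rvLaw p X a - 1) = q a - rvLaw p X a := by
        field_simp
      rw [h3] at h2
      unfold Real.negMulLog
      nlinarith
  calc natEnt p X ≤ ∑ a, (-(rvLaw p X a * Real.log (q a)) + (q a - rvLaw p X a)) :=
        Finset.sum_le_sum fun a _ => key a
    _ ≤ _ := by
        rw [Finset.sum_add_distrib, Finset.sum_sub_distrib, sum_rvLaw, hp.2]
        linarith

/-- Conditional form of Gibbs' inequality. -/
theorem natEnt_prodMk_sub_le (hp : IsProb p) (X : Ω → α) (Y : Ω → β) (q : β → α → ℝ)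
    (hq : ∀ b a, 0 < q b a) (hq1 : ∀ b, ∑ a, q b a ≤ 1) :
    natEnt p (fun ω => (X ω, Y ω)) - natEnt p Y ≤ -∑ ω, p ω * Real.log (q (Y ω) (X ω)) := by
  have h := natEnt_le hp (fun ω => (X ω, Y ω)) (fun c => q c.2 c.1 * rvLaw p Y c.2)
    (fun c => mul_nonneg (hq _ _).le (rvLaw_nonneg hp.1 _ _))
    (by
      rw [Fintype.sum_prod_type_right]
      calc ∑ b, ∑ a, q b a * rvLaw p Y b ≤ ∑ b, rvLaw p Y b := by
            refine Finset.sum_le_sum fun b _ => ?_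
            rw [← Finset.sum_mul]
            exact mul_le_of_le_one_left (rvLaw_nonneg hp.1 _ _) (hq1 b)
        _ = 1 := by rw [sum_rvLaw, hp.2]
        _ ≤ 1 := le_rfl)
    (fun ω hω => mul_pos (hq _ _) (hω.trans_le (le_rvLaw hp.1 Y ω)))
  have h2 : ∀ ω, p ω * Real.log (q (Y ω) (X ω) * rvLaw p Y (Y ω)) =
      p ω * Real.log (q (Y ω) (X ω)) + p ω * Real.log (rvLaw p Y (Y ω)) := by
    intro ω
    rcases (hp.1 ω).eq_or_lt with h0 | h0
    · simp [← h0]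
    · rw [Real.log_mul (hq _ _).ne' (h0.trans_le (le_rvLaw hp.1 Y ω)).ne', mul_add]
  simp only [h2, Finset.sum_add_distrib] at h
  rw [natEnt_eq_sum p Y]
  linarith

/-- The error term in the form of Fano's inequality used here. -/
noncomputable def fanoSlack (ε : ℝ) : ℝ := Real.negMulLog ε - Real.log (1 - ε)

/-- Fano's inequality. -/
theorem natEnt_fano {M : ℕ} (hM : 0 < M) (hp : IsProb p) (A : Ω → Fin M) (B : Ω → β)
    (d : β → Fin M) {ε : ℝ} (h0 : 0 < ε) (h1 : ε < 1)
    (he : 1 - ε ≤ ∑ ω ∈ univ.filter (fun ω => d (B ω) = A ω), p ω) :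
    natEnt p (fun ω => (A ω, B ω)) - natEnt p B ≤ fanoSlack ε + ε * Real.log M := by
  have hM' : (0 : ℝ) < M := by exact_mod_cast hM
  have hM1 : (1 : ℝ) ≤ M := by exact_mod_cast hM
  have hpos : 0 < ε / M := by positivity
  refine (natEnt_prodMk_sub_le hp A B
    (fun b a => (if d b = a then 1 - ε else 0) + ε / M)
    (fun b a => by split_ifs <;> linarith)
    (fun b => by
      rw [Finset.sum_add_distrib]
      simp only [Finset.sum_ite_eq, Finset.mem_univ, if_true, Finset.sum_const, Finset.card_univ,
        Fintype.card_fin, nsmul_eq_mul]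
      rw [mul_div_cancel₀ _ hM'.ne']; linarith)).trans ?_
  have hlogε : Real.log ε ≤ 0 := Real.log_nonpos h0.le h1.le
  have hlogM : 0 ≤ Real.log M := Real.log_nonneg hM1
  have hlog1 : Real.log (1 - ε) ≤ 0 := Real.log_nonpos (by linarith) (by linarith)
  have hsplit := Finset.sum_filter_add_sum_filter_not univ (fun ω => d (B ω) = A ω) p
  rw [hp.2] at hsplit
  have key : ∀ ω, -(p ω * Real.log ((if d (B ω) = A ω then 1 - ε else 0) + ε / M)) ≤
      p ω * (-Real.log (1 - ε)) +
        (if ¬ d (B ω) = A ω then p ω else 0) * (Real.log M - Real.log ε) := by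
    intro ω
    have hpω := hp.1 ω
    by_cases h : d (B ω) = A ω
    · simp only [h, if_true, not_true, if_false, zero_mul, add_zero]
      have : Real.log (1 - ε) ≤ Real.log (1 - ε + ε / M) :=
        Real.log_le_log (by linarith) (by linarith)
      nlinarith
    · simp only [h, if_false, not_false_iff, if_true, zero_add]
      rw [Real.log_div h0.ne' hM'.ne']
      nlinarith
  rw [← Finset.sum_neg_distrib]
  refine (Finset.sum_le_sum fun ω _ => key ω).trans ?_
  rw [Finset.sum_add_distrib, ← Finset.sum_mul, ← Finset.sum_mul, hp.2, ← Finset.sum_filter]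
  unfold fanoSlack Real.negMulLog
  nlinarith

theorem natEnt_pi_le {n : ℕ} (hp : IsProb p) (X : Ω → Fin n → α) :
    natEnt p X ≤ ∑ t, natEnt p (fun ω => X ω t) := by
  refine (natEnt_le hp X (fun x => ∏ t, rvLaw p (fun ω => X ω t) (x t))
    (fun x => Finset.prod_nonneg fun t _ => rvLaw_nonneg hp.1 _ _) ?_ ?_).trans ?_
  · rw [← Fintype.piFinset_univ, ← Finset.prod_univ_sum (fun _ => univ)
      (fun t a => rvLaw p (fun ω => X ω t) a)]
    simp [sum_rvLaw, hp.2]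
  · exact fun ω hω => Finset.prod_pos fun t _ => hω.trans_le (le_rvLaw hp.1 (fun ω => X ω t) ω)
  · simp only [natEnt_eq_sum, Finset.sum_neg_distrib]
    rw [Finset.sum_comm, neg_le_neg_iff]
    refine Finset.sum_le_sum fun ω _ => ?_
    rcases (hp.1 ω).eq_or_lt with h0 | h0
    · simp [← h0]
    · rw [Real.log_prod fun t _ => (h0.trans_le (le_rvLaw hp.1 (fun ω => X ω t) ω)).ne',
        Finset.mul_sum]

theorem natEnt_uniform [Nonempty α] (X : Ω → α)
    (hX : ∀ a, rvLaw p X a = (Fintype.card α : ℝ)⁻¹) : natEnt p X = Real.log (Fintype.card α) := by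
  have hM' : (Fintype.card α : ℝ) ≠ 0 := by exact_mod_cast Fintype.card_ne_zero
  simp only [natEnt, hX, Real.negMulLog, Real.log_inv, Finset.sum_const, Finset.card_univ,
    nsmul_eq_mul]
  field_simp

end Entropy

/-- The transition probabilities from `𝒳` to the function `f` of the channel output. -/
def outKernel {𝒳 𝒵 β : Type*} [Fintype 𝒵] [DecidableEq β] (W : 𝒳 → 𝒵 → ℝ) (f : 𝒵 → β)
    (x : 𝒳) (b : β) : ℝ :=
  ∑ z ∈ univ.filter (fun z => f z = b), W x z

/-- For a probability vector `q`, the entropy of the output of the channel `V` with input law `q`;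
extended to all vectors so as to be homogeneous of degree one. -/
noncomputable def outEnt {𝒳 β : Type*} [Fintype 𝒳] [Fintype β] (V : 𝒳 → β → ℝ) (q : 𝒳 → ℝ) : ℝ :=
  ∑ b, Real.negMulLog (∑ x, q x * V x b) - Real.negMulLog (∑ x, q x)

/-- The joint law of the message and the output block of a memoryless channel `W`, when the message
has law `c` and `enc` is the encoder. -/
def blockLaw {𝓜 𝒳 𝒵 : Type*} {n : ℕ} (W : 𝒳 → 𝒵 → ℝ) (c : 𝓜 → ℝ) (enc : 𝓜 → Fin n → 𝒳)
    (ω : 𝓜 × (Fin n → 𝒵)) : ℝ :=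
  c ω.1 * ∏ t, W (enc ω.1 t) (ω.2 t)

section OutEnt

variable {𝒳 𝒵 β : Type*} [Fintype 𝒳] [Fintype 𝒵] [Fintype β] [DecidableEq β]

omit [Fintype 𝒳] in
theorem sum_outKernel (W : 𝒳 → 𝒵 → ℝ) (f : 𝒵 → β) (x : 𝒳) :
    ∑ b, outKernel W f x b = ∑ z, W x z :=
  sum_rvLaw (W x) f

omit [DecidableEq β] in
theorem outEnt_smul {V : 𝒳 → β → ℝ} (hV : ∀ x, ∑ b, V x b = 1) (a : ℝ) (q : 𝒳 → ℝ) :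
    outEnt V (a • q) = a * outEnt V q := by
  have h : ∑ b, ∑ x, q x * V x b = ∑ x, q x := by
    rw [Finset.sum_comm]
    refine Finset.sum_congr rfl fun x _ => ?_
    rw [← Finset.mul_sum, hV, mul_one]
  simp only [outEnt, Pi.smul_apply, smul_eq_mul, mul_assoc, ← Finset.mul_sum, Real.negMulLog_mul,
    Finset.sum_add_distrib, ← Finset.sum_mul, h]
  ring

omit [DecidableEq β] in
theorem continuous_outEnt (V : 𝒳 → β → ℝ) : Continuous (outEnt V) := by
  unfold outEnt
  fun_prop

variable {Ω σ : Type*} [Fintype Ω] [Fintype σ] [DecidableEq σ] [DecidableEq 𝒳]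

/-- If `S → X → Y` is a Markov chain with transition probabilities `V` from `X` to `Y`, then
`H(Y | S)` is a sum of terms `outEnt V`. -/
theorem natEnt_prodMk_sub_eq {p : Ω → ℝ} {V : 𝒳 → β → ℝ} (S : Ω → σ) (X : Ω → 𝒳) (Y : Ω → β)
    (h : ∀ s b, rvLaw p (fun ω => (S ω, Y ω)) (s, b) =
      ∑ x, rvLaw p (fun ω => (S ω, X ω)) (s, x) * V x b) :
    natEnt p (fun ω => (S ω, Y ω)) - natEnt p S =
      ∑ s, outEnt V (fun x => rvLaw p (fun ω => (S ω, X ω)) (s, x)) := by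
  simp only [outEnt, natEnt, Fintype.sum_prod_type, h, rvLaw_prodMk_sum, Finset.sum_sub_distrib]

end OutEnt

section Block

variable {𝓜 𝒳 𝒵 β σ : Type*} {n : ℕ} [Fintype 𝓜] [Fintype 𝒵]
  {W : 𝒳 → 𝒵 → ℝ} {c : 𝓜 → ℝ} {enc : 𝓜 → Fin n → 𝒳}

/-- Averaging out the coordinate `r` under a product law. -/
theorem sum_mul_prod_eq_of_update (w : Fin n → 𝒵 → ℝ)
    (hw : ∀ t, ∑ z, w t z = 1)
    (r : Fin n) (F : (Fin n → 𝒵) → ℝ) (hF : ∀ y a, F (Function.update y r a) = F y) (φ : 𝒵 → ℝ) :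
    ∑ y, F y * φ (y r) * ∏ t, w t (y t) =
      ∑ y, F y * (∑ a, w r a * φ a) * ∏ t, w t (y t) := by
  let e : (Fin n → 𝒵) × 𝒵 ≃ (Fin n → 𝒵) × 𝒵 :=
    { toFun := fun q => (Function.update q.1 r q.2, q.1 r)
      invFun := fun q => (Function.update q.1 r q.2, q.1 r)
      left_inv := fun q => by simp
      right_inv := fun q => by simp }
  have hprod : ∀ y a, w r (y r) * ∏ t, w t (Function.update y r a t) =
      w r a * ∏ t, w t (y t) := by
    intro y a
    rw [← Finset.mul_prod_erase univ (fun t => w t (y t)) (Finset.mem_univ r),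
      ← Finset.mul_prod_erase univ (fun t => w t (Function.update y r a t)) (Finset.mem_univ r)]
    have : ∏ t ∈ univ.erase r, w t (Function.update y r a t) =
        ∏ t ∈ univ.erase r, w t (y t) :=
      Finset.prod_congr rfl fun t ht => by
        rw [Function.update_of_ne (Finset.ne_of_mem_erase ht)]
    rw [this, Function.update_self]
    ring
  calc ∑ y, F y * φ (y r) * ∏ t, w t (y t)
      = ∑ q : (Fin n → 𝒵) × 𝒵, w r q.2 * (F q.1 * φ (q.1 r) * ∏ t, w t (q.1 t)) := by
        rw [Fintype.sum_prod_type]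
        refine Finset.sum_congr rfl fun y _ => ?_
        simp only
        rw [← Finset.sum_mul, hw, one_mul]
    _ = ∑ q : (Fin n → 𝒵) × 𝒵, F q.1 * (w r q.2 * φ q.2) * ∏ t, w t (q.1 t) := by
        rw [← e.sum_comp]
        refine Finset.sum_congr rfl fun q _ => ?_
        simp only [e, Equiv.coe_fn_mk, hF, Function.update_self]
        linear_combination F q.1 * φ q.2 * hprod q.1 q.2
    _ = _ := by
        rw [Fintype.sum_prod_type]
        refine Finset.sum_congr rfl fun y _ => ?_
        simp only
        rw [← Finset.sum_mul, ← Finset.mul_sum]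

omit [Fintype 𝓜] in
theorem sum_blockLaw_snd (hW : ∀ x, ∑ z, W x z = 1) (m : 𝓜) :
    ∑ y : Fin n → 𝒵, blockLaw W c enc (m, y) = c m := by
  simp only [blockLaw]
  rw [← Finset.mul_sum, ← Fintype.piFinset_univ, ← Finset.prod_univ_sum (fun _ => univ)
    (fun t z => W (enc m t) z)]
  simp [hW]

theorem isProb_blockLaw (hW0 : ∀ x z, 0 ≤ W x z) (hW : ∀ x, ∑ z, W x z = 1) (hc : IsProb c) :
    IsProb (blockLaw W c enc) :=
  ⟨fun ω => mul_nonneg (hc.1 _) (Finset.prod_nonneg fun _ _ => hW0 _ _), by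
    rw [Fintype.sum_prod_type]
    simp only [sum_blockLaw_snd hW, hc.2]⟩

theorem rvLaw_blockLaw_fst [DecidableEq σ] (hW : ∀ x, ∑ z, W x z = 1) (g : 𝓜 → σ) (s : σ) :
    rvLaw (blockLaw W c enc) (fun ω => g ω.1) s = rvLaw c g s := by
  simp only [rvLaw, Finset.sum_filter]
  rw [Fintype.sum_prod_type]
  refine Finset.sum_congr rfl fun m _ => ?_
  by_cases h : g m = s <;> simp [h, sum_blockLaw_snd hW]

/-- The channel is memoryless: if `S` does not depend on the output at time `r`, then `S`, the
input at time `r`, and the output at time `r` form a Markov chain. -/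
theorem rvLaw_blockLaw_markov [Fintype 𝒳] [DecidableEq 𝒳] [DecidableEq β] [DecidableEq σ]
    (hW : ∀ x, ∑ z, W x z = 1) (r : Fin n) (f : 𝒵 → β) (S : 𝓜 × (Fin n → 𝒵) → σ)
    (hS : ∀ m y a, S (m, Function.update y r a) = S (m, y)) (s : σ) (b : β) :
    rvLaw (blockLaw W c enc) (fun ω => (S ω, f (ω.2 r))) (s, b) =
      ∑ x, rvLaw (blockLaw W c enc) (fun ω => (S ω, enc ω.1 r)) (s, x) * outKernel W f x b := by
  have h1 : ∑ x, rvLaw (blockLaw W c enc) (fun ω => (S ω, enc ω.1 r)) (s, x) * outKernel W f x b =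
      ∑ ω, (if S ω = s then 1 else 0) * outKernel W f (enc ω.1 r) b * blockLaw W c enc ω := by
    simp only [rvLaw, Finset.sum_mul, Finset.sum_filter, Prod.mk.injEq, ite_mul, zero_mul]
    rw [Finset.sum_comm]
    refine Finset.sum_congr rfl fun ω _ => ?_
    by_cases h : S ω = s <;> simp [h, mul_comm]
  rw [h1]
  simp only [rvLaw, Finset.sum_filter]
  rw [Fintype.sum_prod_type, Fintype.sum_prod_type]
  refine Finset.sum_congr rfl fun m _ => ?_
  have h2 := sum_mul_prod_eq_of_update (fun t => W (enc m t)) (fun t => hW _) r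
    (fun y => (if S (m, y) = s then 1 else 0) * c m) (fun y a => by simp only [hS])
    (fun z => if f z = b then 1 else 0)
  have h3 : outKernel W f (enc m r) b = ∑ a, W (enc m r) a * (if f a = b then 1 else 0) := by
    simp [outKernel, Finset.sum_filter]
  rw [← h3] at h2
  simp only [blockLaw, Prod.mk.injEq]
  refine Eq.trans (Finset.sum_congr rfl fun y _ => ?_)
    (h2.trans (Finset.sum_congr rfl fun y _ => ?_))
  · by_cases h : S (m, y) = s <;> by_cases h' : f (y r) = b <;> simp [h, h']
  · ring

theorem natEnt_blockLaw_sub [Fintype 𝒳] [DecidableEq 𝒳] [Fintype β] [DecidableEq β] [Fintype σ]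
    [DecidableEq σ]
    (hW : ∀ x, ∑ z, W x z = 1) (r : Fin n) (f : 𝒵 → β) (S : 𝓜 × (Fin n → 𝒵) → σ)
    (hS : ∀ m y a, S (m, Function.update y r a) = S (m, y)) :
    natEnt (blockLaw W c enc) (fun ω => (S ω, f (ω.2 r))) - natEnt (blockLaw W c enc) S =
      ∑ s, outEnt (outKernel W f)
        (fun x => rvLaw (blockLaw W c enc) (fun ω => (S ω, enc ω.1 r)) (s, x)) :=
  natEnt_prodMk_sub_eq S (fun ω => enc ω.1 r) _
    (fun s b => rvLaw_blockLaw_markov hW r f S hS s b)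

end Block

/-- The first `r` entries of the block `y`, observed through `f`. -/
def blockPrefix {𝒵 β : Type*} {n : ℕ} (f : 𝒵 → β) (r : ℕ) (y : Fin n → 𝒵) (t : Fin n) : Option β :=
  if t.val < r then some (f (y t)) else none

/-- The entries of the block `y` from time `r` on, observed through `f`. -/
def blockSuffix {𝒵 β : Type*} {n : ℕ} (f : 𝒵 → β) (r : ℕ) (y : Fin n → 𝒵) (t : Fin n) : Option β :=
  if r ≤ t.val then some (f (y t)) else none

section Prefix

variable {𝒵 β : Type*} {n : ℕ} {f : 𝒵 → β}

theorem blockPrefix_eq_iff {r : ℕ} {y y' : Fin n → 𝒵} :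
    blockPrefix f r y = blockPrefix f r y' ↔ ∀ t : Fin n, t.val < r → f (y t) = f (y' t) := by
  rw [funext_iff]
  refine forall_congr' fun t => ?_
  by_cases h : t.val < r <;> simp [blockPrefix, h]

theorem blockSuffix_eq_iff {r : ℕ} {y y' : Fin n → 𝒵} :
    blockSuffix f r y = blockSuffix f r y' ↔ ∀ t : Fin n, r ≤ t.val → f (y t) = f (y' t) := by
  rw [funext_iff]
  refine forall_congr' fun t => ?_
  by_cases h : r ≤ t.val <;> simp [blockSuffix, h]

theorem blockPrefix_succ_eq_iff {r : Fin n} {y y' : Fin n → 𝒵} :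
    blockPrefix f (r + 1) y = blockPrefix f (r + 1) y' ↔
      blockPrefix f r y = blockPrefix f r y' ∧ f (y r) = f (y' r) := by
  simp only [blockPrefix_eq_iff]
  constructor
  · exact fun h => ⟨fun t ht => h t (by omega), h r (by omega)⟩
  · rintro ⟨h1, h2⟩ t ht
    rcases Nat.lt_succ_iff_lt_or_eq.1 ht with h | h
    · exact h1 t h
    · rwa [Fin.ext h]

theorem blockSuffix_eq_iff_succ {r : Fin n} {y y' : Fin n → 𝒵} :
    blockSuffix f r y = blockSuffix f r y' ↔
      blockSuffix f (r + 1) y = blockSuffix f (r + 1) y' ∧ f (y r) = f (y' r) := by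
  simp only [blockSuffix_eq_iff]
  constructor
  · exact fun h => ⟨fun t ht => h t (by omega), h r le_rfl⟩
  · rintro ⟨h1, h2⟩ t ht
    rcases ht.eq_or_lt with h | h
    · rwa [← Fin.ext h]
    · exact h1 t h

theorem blockPrefix_update (r : Fin n) (y : Fin n → 𝒵) (a : 𝒵) :
    blockPrefix f r (Function.update y r a) = blockPrefix f r y :=
  blockPrefix_eq_iff.2 fun t ht => by
    rw [Function.update_of_ne (fun h => by simp [h] at ht)]

theorem blockSuffix_succ_update (r : Fin n) (y : Fin n → 𝒵) (a : 𝒵) :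
    blockSuffix f (r + 1) (Function.update y r a) = blockSuffix f (r + 1) y :=
  blockSuffix_eq_iff.2 fun t ht => by
    rw [Function.update_of_ne (fun h => by simp [h] at ht)]

end Prefix

theorem sum_fin_succ_sub (n : ℕ) (c : ℕ → ℝ) :
    ∑ t : Fin n, (c (t + 1) - c t) = c n - c 0 := by
  rw [Fin.sum_univ_eq_sum_range (fun t => c (t + 1) - c t), Finset.sum_range_sub]

section Converse

variable {𝓜 𝒳 𝒵 α β γ : Type*} {n : ℕ} [Fintype 𝓜] [Fintype 𝒵] [Fintype α] [DecidableEq α]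
  [Fintype β] [DecidableEq β] [Fintype γ] [DecidableEq γ]

/-- The chain rule for a block of outputs. -/
theorem natEnt_block_chain (p : 𝓜 × (Fin n → 𝒵) → ℝ) (A : 𝓜 → α) (f : 𝒵 → β) :
    ∑ r : Fin n, (natEnt p (fun ω => ((A ω.1, blockPrefix f r ω.2), f (ω.2 r))) -
        natEnt p (fun ω => (A ω.1, blockPrefix f r ω.2))) =
      natEnt p (fun ω => (A ω.1, fun t => f (ω.2 t))) - natEnt p (fun ω => A ω.1) := by
  have h := sum_fin_succ_sub n (fun r => natEnt p (fun ω => (A ω.1, blockPrefix f r ω.2)))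
  have h0 : natEnt p (fun ω => (A ω.1, blockPrefix f 0 ω.2)) = natEnt p (fun ω => A ω.1) :=
    natEnt_congr p fun ω ω' => by simp [blockPrefix_eq_iff]
  have hn : natEnt p (fun ω => (A ω.1, blockPrefix f n ω.2)) =
      natEnt p (fun ω => (A ω.1, fun t => f (ω.2 t))) :=
    natEnt_congr p fun ω ω' => by
      simp only [Prod.mk.injEq, blockPrefix_eq_iff]
      simp [funext_iff]
  simp only [h0, hn] at h
  rw [← h]
  refine Finset.sum_congr rfl fun r _ => ?_
  congr 1
  exact natEnt_congr p fun ω ω' => by simp [blockPrefix_succ_eq_iff, and_assoc]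

variable [Fintype 𝒳] [DecidableEq 𝒳] {W : 𝒳 → 𝒵 → ℝ} {c : 𝓜 → ℝ} {enc : 𝓜 → Fin n → 𝒳}

/-- A conditional form of the less-noisy property: conditioning on more reduces the entropy of the
better output by at least as much as that of the worse one. -/
theorem natEnt_lessNoisy {τ υ : Type*} [Fintype τ] [DecidableEq τ] [Fintype υ] [DecidableEq υ]
    (hW0 : ∀ x z, 0 ≤ W x z) (hW : ∀ x, ∑ z, W x z = 1) (hc : IsProb c)
    (f : 𝒵 → β) (g : 𝒵 → γ)
    (hfg : ∀ ν : υ → 𝒳 → ℝ, (∀ s x, 0 ≤ ν s x) →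
      ∑ s, (outEnt (outKernel W f) (ν s) - outEnt (outKernel W g) (ν s)) ≤
        outEnt (outKernel W f) (∑ s, ν s) - outEnt (outKernel W g) (∑ s, ν s))
    (r : Fin n) (T : 𝓜 × (Fin n → 𝒵) → τ) (U : 𝓜 × (Fin n → 𝒵) → υ)
    (hT : ∀ m y a, T (m, Function.update y r a) = T (m, y))
    (hU : ∀ m y a, U (m, Function.update y r a) = U (m, y)) :
    natEnt (blockLaw W c enc) (fun ω => ((T ω, U ω), f (ω.2 r))) -
        natEnt (blockLaw W c enc) (fun ω => ((T ω, U ω), g (ω.2 r))) ≤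
      natEnt (blockLaw W c enc) (fun ω => (T ω, f (ω.2 r))) -
        natEnt (blockLaw W c enc) (fun ω => (T ω, g (ω.2 r))) := by
  have hp := isProb_blockLaw (enc := enc) hW0 hW hc
  have hTU : ∀ m y a, (fun ω => (T ω, U ω)) (m, Function.update y r a) =
      (fun ω => (T ω, U ω)) (m, y) := fun m y a => by simp only [hT, hU]
  have h1 := natEnt_blockLaw_sub (c := c) (enc := enc) hW r f (fun ω => (T ω, U ω)) hTU
  have h2 := natEnt_blockLaw_sub (c := c) (enc := enc) hW r g (fun ω => (T ω, U ω)) hTU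
  have h3 := natEnt_blockLaw_sub (c := c) (enc := enc) hW r f T hT
  have h4 := natEnt_blockLaw_sub (c := c) (enc := enc) hW r g T hT
  have key : ∑ s, outEnt (outKernel W f)
        (fun x => rvLaw (blockLaw W c enc) (fun ω => ((T ω, U ω), enc ω.1 r)) (s, x)) -
      ∑ s, outEnt (outKernel W g)
        (fun x => rvLaw (blockLaw W c enc) (fun ω => ((T ω, U ω), enc ω.1 r)) (s, x)) ≤
      ∑ s, outEnt (outKernel W f)
        (fun x => rvLaw (blockLaw W c enc) (fun ω => (T ω, enc ω.1 r)) (s, x)) -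
      ∑ s, outEnt (outKernel W g)
        (fun x => rvLaw (blockLaw W c enc) (fun ω => (T ω, enc ω.1 r)) (s, x)) := by
    rw [← Finset.sum_sub_distrib, ← Finset.sum_sub_distrib, Fintype.sum_prod_type]
    refine Finset.sum_le_sum fun s _ => ?_
    have hs : (fun x => rvLaw (blockLaw W c enc) (fun ω => (T ω, enc ω.1 r)) (s, x)) =
        ∑ u, fun x => rvLaw (blockLaw W c enc) (fun ω => ((T ω, U ω), enc ω.1 r)) ((s, u), x) := by
      funext x
      rw [Finset.sum_apply, ← rvLaw_prodMk_sum _ _ U]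
      refine Finset.sum_congr rfl fun u _ => ?_
      unfold rvLaw
      congr 1
      ext ω
      simp only [Finset.mem_filter, Prod.mk.injEq]
      tauto
    rw [hs]
    exact hfg _ fun u x => rvLaw_nonneg hp.1 _ _
  linarith

/-- Replacing the outputs of a less noisy receiver by those of the noisier one in the
conditioning. -/
theorem natEnt_block_sub_le (hW0 : ∀ x z, 0 ≤ W x z) (hW : ∀ x, ∑ z, W x z = 1) (hc : IsProb c)
    (f : 𝒵 → β) (g : 𝒵 → γ)
    (hfg : ∀ ν : (Fin n → Option β) → 𝒳 → ℝ, (∀ s x, 0 ≤ ν s x) →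
      ∑ s, (outEnt (outKernel W f) (ν s) - outEnt (outKernel W g) (ν s)) ≤
        outEnt (outKernel W f) (∑ s, ν s) - outEnt (outKernel W g) (∑ s, ν s))
    (A : 𝓜 → α) :
    natEnt (blockLaw W c enc) (fun ω => (A ω.1, fun t => f (ω.2 t))) -
        natEnt (blockLaw W c enc) (fun ω => A ω.1) ≤
      ∑ r : Fin n,
        (natEnt (blockLaw W c enc) (fun ω => ((A ω.1, blockPrefix g r ω.2), f (ω.2 r))) -
          natEnt (blockLaw W c enc) (fun ω => (A ω.1, blockPrefix g r ω.2))) := by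
  set p := blockLaw W c enc with hpdef
  have h := sum_fin_succ_sub n (fun r =>
    natEnt p (fun ω => ((A ω.1, blockPrefix g r ω.2), blockSuffix f r ω.2)))
  have h0 : natEnt p (fun ω => ((A ω.1, blockPrefix g 0 ω.2), blockSuffix f 0 ω.2)) =
      natEnt p (fun ω => (A ω.1, fun t => f (ω.2 t))) :=
    natEnt_congr p fun ω ω' => by
      simp only [Prod.mk.injEq, blockPrefix_eq_iff, blockSuffix_eq_iff]
      simp [funext_iff]
  have hn : natEnt p (fun ω => ((A ω.1, blockPrefix g n ω.2), blockSuffix f n ω.2)) =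
      natEnt p (fun ω => (A ω.1, fun t => g (ω.2 t))) :=
    natEnt_congr p fun ω ω' => by
      have : ∀ t : Fin n, ¬ n ≤ t.val := fun t => by omega
      simp only [Prod.mk.injEq, blockPrefix_eq_iff, blockSuffix_eq_iff]
      simp [funext_iff, this]
  simp only [h0, hn] at h
  have hchain := natEnt_block_chain p A g
  have hstep : ∀ r : Fin n,
      -(natEnt p (fun ω => ((A ω.1, blockPrefix g (r + 1) ω.2), blockSuffix f (r + 1) ω.2)) -
        natEnt p (fun ω => ((A ω.1, blockPrefix g r ω.2), blockSuffix f r ω.2))) ≤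
      natEnt p (fun ω => ((A ω.1, blockPrefix g r ω.2), f (ω.2 r))) -
        natEnt p (fun ω => ((A ω.1, blockPrefix g r ω.2), g (ω.2 r))) := by
    intro r
    have h1 : natEnt p (fun ω => ((A ω.1, blockPrefix g r ω.2), blockSuffix f r ω.2)) =
        natEnt p (fun ω => (((A ω.1, blockPrefix g r ω.2), blockSuffix f (r + 1) ω.2),
          f (ω.2 r))) :=
      natEnt_congr p fun ω ω' => by simp [blockSuffix_eq_iff_succ, and_assoc]
    have h2 : natEnt p
          (fun ω => ((A ω.1, blockPrefix g (r + 1) ω.2), blockSuffix f (r + 1) ω.2)) =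
        natEnt p (fun ω => (((A ω.1, blockPrefix g r ω.2), blockSuffix f (r + 1) ω.2),
          g (ω.2 r))) :=
      natEnt_congr p fun ω ω' => by
        simp only [Prod.mk.injEq, blockPrefix_succ_eq_iff]
        tauto
    rw [h1, h2, neg_sub]
    exact natEnt_lessNoisy hW0 hW hc f g hfg r (fun ω => (A ω.1, blockPrefix g r ω.2))
      (fun ω => blockSuffix f (r + 1) ω.2)
      (fun m y a => by simp only [blockPrefix_update])
      (fun m y a => by simp only [blockSuffix_succ_update])
  have hsum := Finset.sum_le_sum fun r (_ : r ∈ univ) => hstep r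
  rw [Finset.sum_neg_distrib, h] at hsum
  simp only [Finset.sum_sub_distrib] at hsum hchain ⊢
  linarith

/-- Given the message, the outputs of a memoryless channel are independent. -/
theorem natEnt_block_given_message [DecidableEq 𝓜] (hW : ∀ x, ∑ z, W x z = 1) (f : 𝒵 → β) :
    natEnt (blockLaw W c enc) (fun ω => (ω.1, fun t => f (ω.2 t))) -
        natEnt (blockLaw W c enc) (fun ω => ω.1) =
      ∑ r : Fin n, ∑ x, rvLaw (blockLaw W c enc) (fun ω => enc ω.1 r) x *
        outEnt (outKernel W f) (Pi.single x 1) := by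
  rw [← natEnt_block_chain (blockLaw W c enc) (fun m => m) f]
  refine Finset.sum_congr rfl fun r _ => ?_
  rw [natEnt_blockLaw_sub hW r f (fun ω => (ω.1, blockPrefix f r ω.2))
    (fun m y a => by simp only [blockPrefix_update])]
  have h1 : ∀ s : 𝓜 × (Fin n → Option β),
      (fun x => rvLaw (blockLaw W c enc)
        (fun ω => ((ω.1, blockPrefix f r ω.2), enc ω.1 r)) (s, x)) =
      rvLaw (blockLaw W c enc) (fun ω => (ω.1, blockPrefix f r ω.2)) s •
        Pi.single (enc s.1 r) 1 := by
    intro s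
    funext x
    simp only [Pi.smul_apply, Pi.single_apply, smul_eq_mul, mul_ite, mul_one, mul_zero]
    split_ifs with h
    · unfold rvLaw
      congr 1
      ext ω
      simp only [Finset.mem_filter, Prod.mk.injEq]
      refine and_congr_right fun _ => ⟨fun h => h.1, fun h' => ⟨h', ?_⟩⟩
      rw [h, ← h']
    · refine Finset.sum_eq_zero fun ω hω => absurd ?_ h
      obtain ⟨h2, h3⟩ := Prod.mk.inj (Finset.mem_filter.1 hω).2
      rw [← h3, ← h2]
  simp only [h1, outEnt_smul (fun x => (sum_outKernel W f x).trans (hW x))]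
  rw [sum_rvLaw_mul (blockLaw W c enc) (fun ω => (ω.1, blockPrefix f r ω.2))
    (fun s => outEnt (outKernel W f) (Pi.single (enc s.1 r) 1)),
    sum_rvLaw_mul (blockLaw W c enc) (fun ω => enc ω.1 r)
    (fun x => outEnt (outKernel W f) (Pi.single x 1))]

end Converse

section Rates

variable {𝒳 𝒵 β γ : Type*} {n M₁ M₂ : ℕ} [Fintype 𝒵] [Fintype 𝒳] [DecidableEq 𝒳]
  [Fintype β] [DecidableEq β] [Fintype γ] [DecidableEq γ]
  {W : 𝒳 → 𝒵 → ℝ} {c : Fin M₁ × Fin M₂ → ℝ} {enc : Fin M₁ × Fin M₂ → Fin n → 𝒳} {ε : ℝ}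

/-- The joint law of the auxiliary `(M₂, g(Z)^{r-1})` at time `r` and the input at time `r`. -/
noncomputable def auxLaw (W : 𝒳 → 𝒵 → ℝ) (c : Fin M₁ × Fin M₂ → ℝ)
    (enc : Fin M₁ × Fin M₂ → Fin n → 𝒳) (g : 𝒵 → γ) (r : Fin n)
    (u : Fin M₂ × (Fin n → Option γ)) (x : 𝒳) : ℝ :=
  rvLaw (blockLaw W c enc) (fun ω => ((ω.1.2, blockPrefix g r ω.2), enc ω.1 r)) (u, x)

omit [Fintype 𝒳] in
theorem sum_auxLaw (g : 𝒵 → γ) (r : Fin n) (x : 𝒳) :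
    ∑ u, auxLaw W c enc g r u x = rvLaw (blockLaw W c enc) (fun ω => enc ω.1 r) x := by
  rw [← rvLaw_prodMk_sum _ _ (fun ω => (ω.1.2, blockPrefix g r ω.2))]
  refine Finset.sum_congr rfl fun u _ => ?_
  unfold auxLaw rvLaw
  congr 1
  ext ω
  simp only [Finset.mem_filter, Prod.mk.injEq]
  tauto

omit [Fintype 𝒳] in
theorem sum_auxLaw_fun (g : 𝒵 → γ) (r : Fin n) :
    ∑ u, auxLaw W c enc g r u = rvLaw (blockLaw W c enc) (fun ω => enc ω.1 r) := by
  funext x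
  rw [Finset.sum_apply, sum_auxLaw]

theorem natEnt_output_eq (hW : ∀ x, ∑ z, W x z = 1) (hc : ∑ m, c m = 1) (g : 𝒵 → γ) (r : Fin n) :
    natEnt (blockLaw W c enc) (fun ω => g (ω.2 r)) =
      outEnt (outKernel W g) (rvLaw (blockLaw W c enc) (fun ω => enc ω.1 r)) := by
  have h := natEnt_blockLaw_sub (c := c) (enc := enc) hW r g (fun _ => ()) (fun _ _ _ => rfl)
  have h1 : natEnt (blockLaw W c enc) (fun _ => ()) = 0 := by
    have : ∑ ω, blockLaw W c enc ω = 1 := by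
      rw [Fintype.sum_prod_type]
      simp only [sum_blockLaw_snd hW, hc]
    simp [natEnt, rvLaw, this]
  have h2 : natEnt (blockLaw W c enc) (fun ω => ((), g (ω.2 r))) =
      natEnt (blockLaw W c enc) (fun ω => g (ω.2 r)) :=
    natEnt_congr _ fun ω ω' => by simp
  rw [h1, h2, sub_zero] at h
  rw [h, Fintype.sum_unique]
  congr 1
  funext x
  simp [rvLaw]

theorem fanoSlack_nonneg (h0 : 0 < ε) (h1 : ε < 1) : 0 ≤ fanoSlack ε :=
  sub_nonneg.2 ((Real.log_nonpos (by linarith) (by linarith)).trans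
    (Real.negMulLog_nonneg h0.le h1.le))

omit [Fintype 𝒵] [Fintype 𝒳] [DecidableEq 𝒳] in
theorem isProb_uniform (hM₁ : 0 < M₁) (hM₂ : 0 < M₂) (hc : ∀ m, c m = ((M₁ : ℝ) * M₂)⁻¹) :
    IsProb c := by
  have hM₁' : (M₁ : ℝ) ≠ 0 := by exact_mod_cast hM₁.ne'
  have hM₂' : (M₂ : ℝ) ≠ 0 := by exact_mod_cast hM₂.ne'
  refine ⟨fun m => by rw [hc]; positivity, ?_⟩
  simp only [hc, Finset.sum_const, Finset.card_univ, Fintype.card_prod, Fintype.card_fin,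
    nsmul_eq_mul]
  push_cast
  field_simp

omit [Fintype 𝒳] [DecidableEq 𝒳] in
theorem natEnt_snd_message (hW : ∀ x, ∑ z, W x z = 1) (hM₁ : 0 < M₁) (hM₂ : 0 < M₂)
    (hc : ∀ m, c m = ((M₁ : ℝ) * M₂)⁻¹) :
    natEnt (blockLaw W c enc) (fun ω => ω.1.2) = Real.log M₂ := by
  have hM₁' : (M₁ : ℝ) ≠ 0 := by exact_mod_cast hM₁.ne'
  have hM₂' : (M₂ : ℝ) ≠ 0 := by exact_mod_cast hM₂.ne'
  have : Nonempty (Fin M₂) := ⟨⟨0, hM₂⟩⟩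
  rw [natEnt_uniform, Fintype.card_fin]
  intro a
  rw [rvLaw_blockLaw_fst hW (Prod.snd : Fin M₁ × Fin M₂ → Fin M₂)]
  rw [rvLaw, Finset.sum_filter, Fintype.sum_prod_type]
  simp only [hc, Fintype.card_fin, Finset.sum_ite_eq', Finset.mem_univ, if_true, Finset.sum_const,
    Finset.card_univ, nsmul_eq_mul]
  field_simp

omit [Fintype 𝒳] [DecidableEq 𝒳] in
theorem natEnt_message (hW : ∀ x, ∑ z, W x z = 1) (hM₁ : 0 < M₁) (hM₂ : 0 < M₂)
    (hc : ∀ m, c m = ((M₁ : ℝ) * M₂)⁻¹) :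
    natEnt (blockLaw W c enc) (fun ω => ω.1) = Real.log M₁ + Real.log M₂ := by
  have hM₁' : (M₁ : ℝ) ≠ 0 := by exact_mod_cast hM₁.ne'
  have hM₂' : (M₂ : ℝ) ≠ 0 := by exact_mod_cast hM₂.ne'
  have : Nonempty (Fin M₂) := ⟨⟨0, hM₂⟩⟩
  have : Nonempty (Fin M₁) := ⟨⟨0, hM₁⟩⟩
  rw [natEnt_uniform, Fintype.card_prod, Fintype.card_fin, Fintype.card_fin, Nat.cast_mul,
    Real.log_mul hM₁' hM₂']
  intro a
  refine (rvLaw_blockLaw_fst hW id a).trans ?_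
  rw [rvLaw, Finset.sum_filter]
  simp [hc]

theorem natEnt_sub_eq_sum_auxLaw (hW : ∀ x, ∑ z, W x z = 1) (f : 𝒵 → β) (g : 𝒵 → γ)
    (r : Fin n) :
    natEnt (blockLaw W c enc) (fun ω => ((ω.1.2, blockPrefix g r ω.2), f (ω.2 r))) -
        natEnt (blockLaw W c enc) (fun ω => (ω.1.2, blockPrefix g r ω.2)) =
      ∑ u, outEnt (outKernel W f) (auxLaw W c enc g r u) := by
  rw [natEnt_blockLaw_sub hW r f
    (fun ω : (Fin M₁ × Fin M₂) × (Fin n → 𝒵) => (ω.1.2, blockPrefix g r ω.2))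
    (fun m y a => by simp only [blockPrefix_update])]
  rfl

theorem log_card_snd_le (hW0 : ∀ x z, 0 ≤ W x z) (hW : ∀ x, ∑ z, W x z = 1)
    (hM₁ : 0 < M₁) (hM₂ : 0 < M₂) (hc : ∀ m, c m = ((M₁ : ℝ) * M₂)⁻¹)
    (h0 : 0 < ε) (h1 : ε < 1) (g : 𝒵 → γ) (d : (Fin n → γ) → Fin M₂)
    (he : 1 - ε ≤ ∑ ω ∈ univ.filter (fun ω : (Fin M₁ × Fin M₂) × (Fin n → 𝒵) =>
      d (fun t => g (ω.2 t)) = ω.1.2), blockLaw W c enc ω) :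
    (1 - ε) * Real.log M₂ ≤
      ∑ r, (outEnt (outKernel W g) (∑ u, auxLaw W c enc g r u) -
        ∑ u, outEnt (outKernel W g) (auxLaw W c enc g r u)) + fanoSlack ε := by
  have hcp := isProb_uniform hM₁ hM₂ hc
  have hp := isProb_blockLaw (enc := enc) hW0 hW hcp
  have hfano := natEnt_fano hM₂ hp (fun ω => ω.1.2) (fun ω t => g (ω.2 t)) d h0 h1 he
  have hchain := natEnt_block_chain (blockLaw W c enc) (fun m => m.2) g
  have hunif := natEnt_snd_message (enc := enc) hW hM₁ hM₂ hc
  have hsub := natEnt_pi_le hp (fun ω t => g (ω.2 t))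
  simp only [natEnt_sub_eq_sum_auxLaw hW, hunif] at hchain
  simp only [natEnt_output_eq hW hcp.2] at hsub
  simp only [Finset.sum_sub_distrib, sum_auxLaw_fun]
  linarith

theorem log_card_fst_le (hW0 : ∀ x z, 0 ≤ W x z) (hW : ∀ x, ∑ z, W x z = 1)
    (hM₁ : 0 < M₁) (hM₂ : 0 < M₂) (hc : ∀ m, c m = ((M₁ : ℝ) * M₂)⁻¹)
    (h0 : 0 < ε) (h1 : ε < 1) (f : 𝒵 → β) (g : 𝒵 → γ)
    (hfg : ∀ ν : (Fin n → Option β) → 𝒳 → ℝ, (∀ s x, 0 ≤ ν s x) →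
      ∑ s, (outEnt (outKernel W f) (ν s) - outEnt (outKernel W g) (ν s)) ≤
        outEnt (outKernel W f) (∑ s, ν s) - outEnt (outKernel W g) (∑ s, ν s))
    (d : (Fin n → β) → Fin M₁)
    (he : 1 - ε ≤ ∑ ω ∈ univ.filter (fun ω : (Fin M₁ × Fin M₂) × (Fin n → 𝒵) =>
      d (fun t => f (ω.2 t)) = ω.1.1), blockLaw W c enc ω) :
    (1 - ε) * Real.log M₁ ≤
      ∑ r, (∑ u, outEnt (outKernel W f) (auxLaw W c enc g r u) -
        ∑ x, (∑ u, auxLaw W c enc g r u) x * outEnt (outKernel W f) (Pi.single x 1)) +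
          fanoSlack ε := by
  have hcp := isProb_uniform hM₁ hM₂ hc
  have hp := isProb_blockLaw (enc := enc) hW0 hW hcp
  have hfano := natEnt_fano hM₁ hp (fun ω => ω.1.1) (fun ω => (ω.1.2, fun t => f (ω.2 t)))
    (fun b => d b.2) h0 h1 he
  have hassoc : natEnt (blockLaw W c enc) (fun ω => (ω.1.1, ω.1.2, fun t => f (ω.2 t))) =
      natEnt (blockLaw W c enc) (fun ω => (ω.1, fun t => f (ω.2 t))) :=
    natEnt_congr _ fun ω ω' => by simp only [Prod.ext_iff]; tauto
  have hmsg := natEnt_block_given_message (c := c) (enc := enc) hW f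
  have hunif := natEnt_snd_message (enc := enc) hW hM₁ hM₂ hc
  have hunif' := natEnt_message (enc := enc) hW hM₁ hM₂ hc
  have hless := natEnt_block_sub_le (c := c) (enc := enc) hW0 hW hcp f g hfg (fun m => m.2)
  simp only [natEnt_sub_eq_sum_auxLaw hW, hunif] at hless
  simp only [Finset.sum_sub_distrib, sum_auxLaw_fun]
  linarith

end Rates

section ConvexHull

theorem isCompact_convexHull_of_finiteDimensional {E : Type*} [AddCommGroup E] [Module ℝ E]
    [FiniteDimensional ℝ E] [TopologicalSpace E] [ContinuousAdd E] [ContinuousSMul ℝ E]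
    {s : Set E} (hs : IsCompact s) : IsCompact (convexHull ℝ s) := by
  classical
  rcases s.eq_empty_or_nonempty with rfl | ⟨x₀, hx₀⟩
  · simp
  let d := Module.finrank ℝ E + 1
  let Φ : (Fin d → ℝ) × (Fin d → E) → E := fun q => ∑ i, q.1 i • q.2 i
  have hΦ : Continuous Φ := by fun_prop
  have himage : convexHull ℝ s =
      Φ '' (stdSimplex ℝ (Fin d) ×ˢ Set.univ.pi fun _ => s) := by
    ext x
    constructor
    · intro hx
      obtain ⟨ι, hι, z, w, hz, haff, hw, hw1, hsum⟩ := eq_pos_convex_span_of_mem_convexHull hx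
      have hcard : Fintype.card ι ≤ Fintype.card (Fin d) := by
        rw [Fintype.card_fin]
        exact haff.card_le_finrank_succ.trans
          (Nat.succ_le_succ (Submodule.finrank_le _))
      obtain ⟨e⟩ := Function.Embedding.nonempty_of_card_le hcard
      have hext : ∀ i, Function.extend e w 0 (e i) = w i := fun i => e.injective.extend_apply _ _ _
      have hout : ∀ i, i ∉ univ.map e → Function.extend e w 0 i = 0 := fun i hi =>
        Function.extend_apply' _ _ _ fun ⟨a, ha⟩ => hi (by simp [← ha])
      refine ⟨(Function.extend e w 0, Function.extend e z fun _ => x₀), ⟨⟨fun i => ?_, ?_⟩, ?_⟩, ?_⟩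
      · by_cases hi : ∃ a, e a = i
        · obtain ⟨a, rfl⟩ := hi
          simp only [hext]
          exact (hw a).le
        · simp only [Function.extend_apply' _ _ _ hi, Pi.zero_apply, le_refl]
      · rw [← Finset.sum_subset (Finset.subset_univ (univ.map e)) fun i _ hi => hout i hi,
          Finset.sum_map]
        simp only [hext, hw1]
      · intro i _
        by_cases hi : ∃ a, e a = i
        · obtain ⟨a, rfl⟩ := hi
          simp only [e.injective.extend_apply]
          exact hz ⟨a, rfl⟩
        · simpa only [Function.extend_apply' _ _ _ hi] using hx₀
      · simp only [Φ]
        rw [← Finset.sum_subset (Finset.subset_univ (univ.map e)) fun i _ hi => by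
            rw [hout i hi, zero_smul],
          Finset.sum_map]
        simp only [hext, e.injective.extend_apply, hsum]
    · rintro ⟨⟨w, z⟩, ⟨⟨hw0, hw1⟩, hz⟩, rfl⟩
      exact mem_convexHull_of_exists_fintype w z hw0 hw1 (fun i => hz i trivial) rfl
  rw [himage]
  exact ((isCompact_stdSimplex ℝ _).prod (isCompact_univ_pi fun _ => hs)).image hΦ

variable {𝒳 ι : Type*} [Fintype 𝒳] {β : ι → Type*} [∀ i, Fintype (β i)]

/-- The points `(q, (H(Y_i))_i)`, where `q` ranges over the input laws and `Y_i` is the output of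
the channel `V i` with input law `q`. -/
def entropyGraph (V : ∀ i, 𝒳 → β i → ℝ) : Set ((𝒳 → ℝ) × (ι → ℝ)) :=
  (fun q => (q, fun i => outEnt (V i) q)) '' stdSimplex ℝ 𝒳

theorem isCompact_entropyGraph (V : ∀ i, 𝒳 → β i → ℝ) : IsCompact (entropyGraph V) :=
  (isCompact_stdSimplex ℝ 𝒳).image
    (continuous_id.prodMk (continuous_pi fun i => continuous_outEnt (V i)))

theorem sum_mem_convexHull_entropyGraph {V : ∀ i, 𝒳 → β i → ℝ} (hV : ∀ i x, ∑ b, V i x b = 1)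
    {σ : Type*} [Fintype σ] (ν : σ → 𝒳 → ℝ) (h0 : ∀ s x, 0 ≤ ν s x) (h1 : ∑ s, ∑ x, ν s x = 1) :
    (∑ s, ν s, fun i => ∑ s, outEnt (V i) (ν s)) ∈ convexHull ℝ (entropyGraph V) := by
  classical
  have hw0 : ∀ s, 0 ≤ ∑ x, ν s x := fun s => Finset.sum_nonneg fun x _ => h0 s x
  obtain ⟨x₀⟩ : Nonempty 𝒳 := by
    by_contra hne
    rw [not_nonempty_iff] at hne
    simp at h1
  let q : σ → 𝒳 → ℝ := fun s =>
    if ∑ x, ν s x = 0 then Pi.single x₀ 1 else (∑ x, ν s x)⁻¹ • ν s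
  have hq : ∀ s, (∑ x, ν s x) • q s = ν s := by
    intro s
    by_cases h : ∑ x, ν s x = 0
    · rw [h, zero_smul]
      funext x
      exact ((Finset.sum_eq_zero_iff_of_nonneg fun x _ => h0 s x).1 h x (Finset.mem_univ x)).symm
    · simp only [q, h, if_false]
      rw [smul_smul, mul_inv_cancel₀ h, one_smul]
  have hqmem : ∀ s, q s ∈ stdSimplex ℝ 𝒳 := by
    intro s
    by_cases h : ∑ x, ν s x = 0
    · simp only [q, h, if_true]
      exact single_mem_stdSimplex ℝ x₀
    · simp only [q, h, if_false]
      refine ⟨fun x => mul_nonneg (inv_nonneg.2 (hw0 s)) (h0 s x), ?_⟩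
      simp only [Pi.smul_apply, smul_eq_mul]
      rw [← Finset.mul_sum, inv_mul_cancel₀ h]
  refine mem_convexHull_of_exists_fintype (fun s => ∑ x, ν s x)
    (fun s => (q s, fun i => outEnt (V i) (q s))) hw0 h1 (fun s => ⟨q s, hqmem s, rfl⟩) ?_
  refine Prod.ext ?_ ?_
  · simp only [Prod.fst_sum, Prod.smul_fst, hq]
  · funext i
    simp only [Prod.snd_sum, Prod.smul_snd, Finset.sum_apply, Pi.smul_apply, smul_eq_mul]
    refine Finset.sum_congr rfl fun s _ => ?_
    rw [← outEnt_smul (hV i), hq]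

theorem exists_fin_of_mem_convexHull_entropyGraph {V : ∀ i, 𝒳 → β i → ℝ}
    (hV : ∀ i x, ∑ b, V i x b = 1) {z : (𝒳 → ℝ) × (ι → ℝ)}
    (hz : z ∈ convexHull ℝ (entropyGraph V)) :
    ∃ (m : ℕ) (μ : Fin m → 𝒳 → ℝ), (∀ u x, 0 ≤ μ u x) ∧ ∑ u, ∑ x, μ u x = 1 ∧
      ∑ u, μ u = z.1 ∧ ∀ i, ∑ u, outEnt (V i) (μ u) = z.2 i := by
  rw [convexHull_eq_union] at hz
  simp only [Set.mem_iUnion] at hz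
  obtain ⟨t, ht, -, hz⟩ := hz
  rw [Finset.convexHull_eq] at hz
  obtain ⟨w, hw0, hw1, hsum⟩ := hz
  rw [Finset.centerMass_eq_of_sum_1 _ _ hw1] at hsum
  let e := t.equivFin.symm
  have hmem : ∀ a : t, (a : (𝒳 → ℝ) × (ι → ℝ)).1 ∈ stdSimplex ℝ 𝒳 ∧
      ∀ i, (a : (𝒳 → ℝ) × (ι → ℝ)).2 i = outEnt (V i) (a : (𝒳 → ℝ) × (ι → ℝ)).1 := by
    intro a
    obtain ⟨q, hq, hqa⟩ := ht a.2
    rw [← hqa]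
    exact ⟨hq, fun i => rfl⟩
  refine ⟨t.card, fun u => w (e u) • (e u : (𝒳 → ℝ) × (ι → ℝ)).1, fun u x => ?_, ?_, ?_, fun i => ?_⟩
  · exact mul_nonneg (hw0 _ (e u).2) ((hmem (e u)).1.1 x)
  · simp only [Pi.smul_apply, smul_eq_mul, ← Finset.mul_sum, (hmem _).1.2, mul_one]
    rw [← hw1, e.sum_comp (fun a => w a), Finset.sum_coe_sort t w]
  · rw [← hsum, Prod.fst_sum]
    rw [e.sum_comp (fun a => w a • (a : (𝒳 → ℝ) × (ι → ℝ)).1),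
      Finset.sum_coe_sort t fun a => w a • a.1]
    rfl
  · rw [← hsum, Prod.snd_sum, Finset.sum_apply]
    simp only [outEnt_smul (hV i), ← (hmem _).2 i]
    rw [e.sum_comp (fun a => w a * (a : (𝒳 → ℝ) × (ι → ℝ)).2 i),
      Finset.sum_coe_sort t fun a => w a * a.2 i]
    rfl

end ConvexHull

section OutEntConcave

variable {𝒳 β : Type*} [Fintype 𝒳] [Fintype β]

theorem average_outEnt_le {V : 𝒳 → β → ℝ} (hV0 : ∀ x b, 0 ≤ V x b)
    {n : ℕ} (hn : 0 < n) (q : Fin n → 𝒳 → ℝ)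
    (hq : ∀ t, q t ∈ stdSimplex ℝ 𝒳) :
    (n : ℝ)⁻¹ * ∑ t, outEnt V (q t) ≤ outEnt V ((n : ℝ)⁻¹ • ∑ t, q t) := by
  have hn' : (n : ℝ) ≠ 0 := by exact_mod_cast hn.ne'
  have hw : ∑ _t : Fin n, (n : ℝ)⁻¹ = 1 := by simp [hn']
  have h1 : ∑ x, ((n : ℝ)⁻¹ • ∑ t, q t) x = 1 := by
    simp only [Pi.smul_apply, Finset.sum_apply, smul_eq_mul, ← Finset.mul_sum]
    rw [Finset.sum_comm]
    simp only [(hq _).2, Finset.sum_const, Finset.card_univ, Fintype.card_fin, nsmul_eq_mul]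
    field_simp
  simp only [outEnt, h1, (hq _).2, Real.negMulLog_one, sub_zero]
  rw [Finset.sum_comm, Finset.mul_sum]
  refine Finset.sum_le_sum fun b _ => ?_
  have hJ := Real.concaveOn_negMulLog.le_map_sum (t := univ) (w := fun _ : Fin n => (n : ℝ)⁻¹)
    (p := fun t => ∑ x, q t x * V x b) (fun _ _ => by positivity) hw
    (fun t _ => Finset.sum_nonneg fun x _ => mul_nonneg ((hq t).1 x) (hV0 x b))
  simp only [smul_eq_mul] at hJ
  rw [← Finset.mul_sum] at hJ
  refine hJ.trans_eq (congrArg _ ?_)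
  rw [← Finset.mul_sum, Finset.sum_comm, Finset.mul_sum]
  refine Finset.sum_congr rfl fun x _ => ?_
  simp only [Pi.smul_apply, Finset.sum_apply, smul_eq_mul, ← Finset.sum_mul]
  ring

/-- A homogeneous function that satisfies the concavity inequality for all finite families of total
mass one satisfies it for all finite families of nonnegative functions. -/
theorem sum_le_of_homogeneous {D : (𝒳 → ℝ) → ℝ} (hD : ∀ (a : ℝ) q, D (a • q) = a * D q)
    (h : ∀ (m : ℕ) (μ : Fin m → 𝒳 → ℝ), (∀ u x, 0 ≤ μ u x) → ∑ u, ∑ x, μ u x = 1 →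
      ∑ u, D (μ u) ≤ D (∑ u, μ u))
    {σ : Type*} [Fintype σ] (ν : σ → 𝒳 → ℝ) (hν : ∀ s x, 0 ≤ ν s x) :
    ∑ s, D (ν s) ≤ D (∑ s, ν s) := by
  have hD0 : D 0 = 0 := by simpa using hD 0 0
  rcases (Finset.sum_nonneg fun s (_ : s ∈ univ) =>
    Finset.sum_nonneg fun x (_ : x ∈ univ) => hν s x).eq_or_lt with ha | ha
  · have hz : ∀ s, ν s = 0 := by
      intro s
      have h2 := (Finset.sum_eq_zero_iff_of_nonneg fun s _ =>
        Finset.sum_nonneg fun x _ => hν s x).1 ha.symm s (Finset.mem_univ s)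
      funext x
      exact (Finset.sum_eq_zero_iff_of_nonneg fun x _ => hν s x).1 h2 x (Finset.mem_univ x)
    simp [hz, hD0]
  · set a := ∑ s, ∑ x, ν s x with hadef
    let e := (Fintype.equivFin σ).symm
    have h2 := h (Fintype.card σ) (fun u => a⁻¹ • ν (e u))
      (fun u x => mul_nonneg (inv_nonneg.2 ha.le) (hν _ _)) (by
        simp only [Pi.smul_apply, smul_eq_mul, ← Finset.mul_sum]
        rw [e.sum_comp (fun s => ∑ x, ν s x), ← hadef, inv_mul_cancel₀ ha.ne'])
    simp only [hD, ← Finset.mul_sum, ← Finset.smul_sum] at h2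
    rw [e.sum_comp (fun s => D (ν s)), e.sum_comp ν] at h2
    exact le_of_mul_le_mul_left h2 (inv_pos.2 ha)

end OutEntConcave

section OneShot

variable {υ 𝒳 𝒵 β : Type*} [Fintype υ] [DecidableEq υ] [Fintype 𝒳] [DecidableEq 𝒳] [Fintype 𝒵]
  [Fintype β] [DecidableEq β] {W : 𝒳 → 𝒵 → ℝ} {μ : υ → 𝒳 → ℝ}

/-- The joint law of `(U, X, Z)` when `(U, X)` has law `μ` and `Z` is the output of `W` with
input `X`. -/
def oneShotLaw (W : 𝒳 → 𝒵 → ℝ) (μ : υ → 𝒳 → ℝ) (ω : υ × 𝒳 × 𝒵) : ℝ := μ ω.1 ω.2.1 * W ω.2.1 ω.2.2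

omit [DecidableEq υ] [Fintype β] in
theorem rvLaw_oneShotLaw_markov {σ : Type*} [DecidableEq σ]
    (hW : ∀ x, ∑ z, W x z = 1) (f : 𝒵 → β) (S : υ → 𝒳 → σ) (s : σ) (b : β) :
    rvLaw (oneShotLaw W μ) (fun ω => (S ω.1 ω.2.1, f ω.2.2)) (s, b) =
      ∑ x, rvLaw (oneShotLaw W μ) (fun ω => (S ω.1 ω.2.1, ω.2.1)) (s, x) * outKernel W f x b := by
  have h1 : ∑ x, rvLaw (oneShotLaw W μ) (fun ω => (S ω.1 ω.2.1, ω.2.1)) (s, x) *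
        outKernel W f x b =
      ∑ ω, (if S ω.1 ω.2.1 = s then 1 else 0) * outKernel W f ω.2.1 b * oneShotLaw W μ ω := by
    simp only [rvLaw, Finset.sum_mul, Finset.sum_filter, Prod.mk.injEq, ite_mul, zero_mul]
    rw [Finset.sum_comm]
    refine Finset.sum_congr rfl fun ω _ => ?_
    by_cases h : S ω.1 ω.2.1 = s <;> simp [h, mul_comm]
  rw [h1]
  simp only [rvLaw, Finset.sum_filter, Fintype.sum_prod_type, oneShotLaw, Prod.mk.injEq]
  refine Finset.sum_congr rfl fun u _ => Finset.sum_congr rfl fun x _ => ?_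
  by_cases h : S u x = s
  · simp only [h, true_and, if_true, one_mul, outKernel, Finset.sum_filter]
    rw [← Finset.mul_sum, ← Finset.mul_sum, hW, mul_one, mul_comm, Finset.mul_sum]
    refine Finset.sum_congr rfl fun z _ => ?_
    split_ifs <;> simp
  · simp [h]

theorem rvLaw_oneShotLaw (hW : ∀ x, ∑ z, W x z = 1) (u : υ) (x : 𝒳) :
    rvLaw (oneShotLaw W μ) (fun ω => (ω.1, ω.2.1)) (u, x) = μ u x := by
  simp only [rvLaw, Finset.sum_filter, Fintype.sum_prod_type, oneShotLaw, Prod.mk.injEq]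
  rw [Finset.sum_eq_single u (fun u' _ h => by simp [h]) (by simp),
    Finset.sum_eq_single x (fun x' _ h => by simp [h]) (by simp)]
  simp [← Finset.mul_sum, hW]

theorem natEnt_oneShotLaw_sub (hW : ∀ x, ∑ z, W x z = 1) (f : 𝒵 → β) :
    natEnt (oneShotLaw W μ) (fun ω => (ω.1, f ω.2.2)) - natEnt (oneShotLaw W μ) (fun ω => ω.1) =
      ∑ u, outEnt (outKernel W f) (μ u) := by
  rw [natEnt_prodMk_sub_eq (fun ω : υ × 𝒳 × 𝒵 => ω.1) (fun ω => ω.2.1) (fun ω => f ω.2.2)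
    (rvLaw_oneShotLaw_markov hW f fun u _ => u)]
  simp only [rvLaw_oneShotLaw hW]

theorem natEnt_oneShotLaw_out (hW : ∀ x, ∑ z, W x z = 1) (h1 : ∑ u, ∑ x, μ u x = 1)
    (f : 𝒵 → β) :
    natEnt (oneShotLaw W μ) (fun ω => f ω.2.2) = outEnt (outKernel W f) (∑ u, μ u) := by
  have h2 : ∑ x, (∑ u, μ u) x = 1 := by
    simp only [Finset.sum_apply]
    rw [Finset.sum_comm, h1]
  rw [outEnt, h2, Real.negMulLog_one, sub_zero, natEnt]
  refine Finset.sum_congr rfl fun b _ => congrArg _ ?_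
  have h3 := rvLaw_oneShotLaw_markov (μ := μ) hW f (fun u _ => u)
  have h4 : rvLaw (oneShotLaw W μ) (fun ω => f ω.2.2) b =
      ∑ u, rvLaw (oneShotLaw W μ) (fun ω => (ω.1, f ω.2.2)) (u, b) := by
    rw [← rvLaw_prodMk_sum _ _ (fun ω => ω.1)]
    refine Finset.sum_congr rfl fun u _ => ?_
    unfold rvLaw
    congr 1
    ext ω
    simp only [Finset.mem_filter, Prod.mk.injEq]
    tauto
  rw [h4]
  simp only [h3, rvLaw_oneShotLaw hW, Finset.sum_apply, Finset.sum_mul]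
  rw [Finset.sum_comm]

theorem mutInf_oneShotLaw (hW : ∀ x, ∑ z, W x z = 1) (h1 : ∑ u, ∑ x, μ u x = 1) (f : 𝒵 → β) :
    mutInf (oneShotLaw W μ) (fun ω => ω.1) (fun ω => f ω.2.2) =
      (outEnt (outKernel W f) (∑ u, μ u) - ∑ u, outEnt (outKernel W f) (μ u)) / Real.log 2 := by
  rw [← natEnt_oneShotLaw_sub hW f, ← natEnt_oneShotLaw_out hW h1 f, mutInf, ent_eq_natEnt_div,
    ent_eq_natEnt_div, ent_eq_natEnt_div]
  ring

theorem condMutInf_oneShotLaw (hW : ∀ x, ∑ z, W x z = 1) (f : 𝒵 → β) :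
    condMutInf (oneShotLaw W μ) (fun ω => ω.2.1) (fun ω => f ω.2.2) (fun ω => ω.1) =
      (∑ u, outEnt (outKernel W f) (μ u) -
        ∑ x, (∑ u, μ u) x * outEnt (outKernel W f) (Pi.single x 1)) / Real.log 2 := by
  have h1 := natEnt_oneShotLaw_sub (μ := μ) hW f
  have h2 := natEnt_prodMk_sub_eq (fun ω : υ × 𝒳 × 𝒵 => (ω.2.1, ω.1)) (fun ω => ω.2.1)
    (fun ω => f ω.2.2) (rvLaw_oneShotLaw_markov (μ := μ) hW f fun u x => (x, u))
  have h3 : ∀ s : 𝒳 × υ, (fun x => rvLaw (oneShotLaw W μ)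
      (fun ω => ((ω.2.1, ω.1), ω.2.1)) (s, x)) = μ s.2 s.1 • Pi.single s.1 1 := by
    rintro ⟨x', u⟩
    funext x
    simp only [Pi.smul_apply, Pi.single_apply, smul_eq_mul, mul_ite, mul_one, mul_zero]
    split_ifs with h
    · subst h
      rw [← rvLaw_oneShotLaw (μ := μ) hW u x]
      unfold rvLaw
      congr 1
      ext ω
      simp only [Finset.mem_filter, Prod.mk.injEq]
      tauto
    · refine Finset.sum_eq_zero fun ω hω => absurd ?_ h
      obtain ⟨h2, h3⟩ := Prod.mk.inj (Finset.mem_filter.1 hω).2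
      rw [← h3, ← (Prod.mk.inj h2).1]
  simp only [h3, outEnt_smul (fun x => (sum_outKernel W f x).trans (hW x)),
    Fintype.sum_prod_type] at h2
  have h4 : natEnt (oneShotLaw W μ) (fun ω => (f ω.2.2, ω.1)) =
      natEnt (oneShotLaw W μ) (fun ω => (ω.1, f ω.2.2)) :=
    natEnt_congr _ fun ω ω' => by simp only [Prod.mk.injEq]; tauto
  have h5 : natEnt (oneShotLaw W μ) (fun ω => (ω.2.1, f ω.2.2, ω.1)) =
      natEnt (oneShotLaw W μ) (fun ω => ((ω.2.1, ω.1), f ω.2.2)) :=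
    natEnt_congr _ fun ω ω' => by simp only [Prod.mk.injEq]; tauto
  simp only [Finset.sum_apply, Finset.sum_mul]
  rw [← h1, ← h2, condMutInf, ent_eq_natEnt_div, ent_eq_natEnt_div, ent_eq_natEnt_div,
    ent_eq_natEnt_div, h4, h5]
  ring

end OneShot

section Converse

variable {𝒳 𝒵 ι : Type*} {β : ι → Type*} {n M₁ M₂ : ℕ} [Fintype 𝒵] [Fintype 𝒳] [DecidableEq 𝒳]
  [∀ i, Fintype (β i)] [∀ i, DecidableEq (β i)] {W : 𝒳 → 𝒵 → ℝ}

omit [Fintype 𝒳] in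
theorem auxLaw_nonneg {γ : Type*} [DecidableEq γ] {c : Fin M₁ × Fin M₂ → ℝ}
    {enc : Fin M₁ × Fin M₂ → Fin n → 𝒳} (hW0 : ∀ x z, 0 ≤ W x z) (hW : ∀ x, ∑ z, W x z = 1)
    (hc : IsProb c) (g : 𝒵 → γ) (r : Fin n) (u : Fin M₂ × (Fin n → Option γ)) (x : 𝒳) :
    0 ≤ auxLaw W c enc g r u x :=
  rvLaw_nonneg (isProb_blockLaw hW0 hW hc).1 _ _

theorem sum_auxLaw_mem_stdSimplex {γ : Type*} [Fintype γ] [DecidableEq γ]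
    {c : Fin M₁ × Fin M₂ → ℝ}
    {enc : Fin M₁ × Fin M₂ → Fin n → 𝒳} (hW0 : ∀ x z, 0 ≤ W x z) (hW : ∀ x, ∑ z, W x z = 1)
    (hc : IsProb c) (g : 𝒵 → γ) (r : Fin n) :
    ∑ u, auxLaw W c enc g r u ∈ stdSimplex ℝ 𝒳 := by
  have hp := isProb_blockLaw (enc := enc) hW0 hW hc
  rw [sum_auxLaw_fun]
  exact ⟨rvLaw_nonneg hp.1 _, (sum_rvLaw _ _).trans hp.2⟩

theorem exists_mem_convexHull_of_block (f : ∀ i, 𝒵 → β i) (k : ι) (J : ι → Prop)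
    {c : Fin M₁ × Fin M₂ → ℝ} {enc : Fin M₁ × Fin M₂ → Fin n → 𝒳} {ε : ℝ}
    (hW0 : ∀ x z, 0 ≤ W x z) (hW : ∀ x, ∑ z, W x z = 1) (hn : 0 < n)
    (hM₁ : 0 < M₁) (hM₂ : 0 < M₂) (hc : ∀ m, c m = ((M₁ : ℝ) * M₂)⁻¹)
    (h0 : 0 < ε) (h1 : ε < 1)
    (hfg : ∀ j, J j → ∀ ν : (Fin n → Option (β j)) → 𝒳 → ℝ, (∀ s x, 0 ≤ ν s x) →
      ∑ s, (outEnt (outKernel W (f j)) (ν s) - outEnt (outKernel W (f k)) (ν s)) ≤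
        outEnt (outKernel W (f j)) (∑ s, ν s) - outEnt (outKernel W (f k)) (∑ s, ν s))
    (d : ∀ i, (Fin n → β i) → Fin M₁ × Fin M₂)
    (hek : 1 - ε ≤ ∑ ω ∈ univ.filter (fun ω : (Fin M₁ × Fin M₂) × (Fin n → 𝒵) =>
      (d k (fun t => f k (ω.2 t))).2 = ω.1.2), blockLaw W c enc ω)
    (hej : ∀ j, J j → 1 - ε ≤ ∑ ω ∈ univ.filter (fun ω : (Fin M₁ × Fin M₂) × (Fin n → 𝒵) =>
      (d j (fun t => f j (ω.2 t))).1 = ω.1.1), blockLaw W c enc ω) :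
    ∃ z ∈ convexHull ℝ (entropyGraph fun i => outKernel W (f i)),
      (1 - ε) * (Real.log M₂ / n) ≤ outEnt (outKernel W (f k)) z.1 - z.2 k + fanoSlack ε ∧
      ∀ j, J j → (1 - ε) * (Real.log M₁ / n) ≤
        z.2 j - ∑ x, z.1 x * outEnt (outKernel W (f j)) (Pi.single x 1) + fanoSlack ε := by
  have hn' : (0 : ℝ) < n := by exact_mod_cast hn
  have hn1 : (n : ℝ)⁻¹ ≤ 1 := inv_le_one_of_one_le₀ (by exact_mod_cast hn)
  have hslack : (n : ℝ)⁻¹ * fanoSlack ε ≤ fanoSlack ε :=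
    mul_le_of_le_one_left (fanoSlack_nonneg h0 h1) hn1
  have hcp := isProb_uniform hM₁ hM₂ hc
  have hV : ∀ i x, ∑ b, outKernel W (f i) x b = 1 := fun i x => (sum_outKernel W _ x).trans (hW x)
  set A := auxLaw W c enc (f k)
  have hA0 : ∀ r u x, 0 ≤ A r u x := auxLaw_nonneg hW0 hW hcp (f k)
  have hA1 : ∀ r, ∑ u, A r u ∈ stdSimplex ℝ 𝒳 := sum_auxLaw_mem_stdSimplex hW0 hW hcp (f k)
  have hsum := sum_mem_convexHull_entropyGraph hV
    (fun s : Fin n × (Fin M₂ × (Fin n → Option (β k))) => (n : ℝ)⁻¹ • A s.1 s.2)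
    (fun s x => mul_nonneg (inv_nonneg.2 hn'.le) (hA0 _ _ _)) (by
      simp only [Pi.smul_apply, smul_eq_mul, ← Finset.mul_sum]
      rw [Fintype.sum_prod_type]
      have : ∀ r, ∑ u, ∑ x, A r u x = 1 := fun r => by
        rw [Finset.sum_comm, ← (hA1 r).2]
        simp only [Finset.sum_apply]
      simp [this, hn'.ne'])
  have hmem : ((n : ℝ)⁻¹ • ∑ r, ∑ u, A r u,
      fun i => (n : ℝ)⁻¹ * ∑ r, ∑ u, outEnt (outKernel W (f i)) (A r u)) ∈
        convexHull ℝ (entropyGraph fun i => outKernel W (f i)) := by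
    simpa only [outEnt_smul (hV _), ← Finset.mul_sum, ← Finset.smul_sum,
      Fintype.sum_prod_type] using hsum
  refine ⟨_, hmem, ?_, fun j hj => ?_⟩
  · have h2 := log_card_snd_le hW0 hW hM₁ hM₂ hc h0 h1 (f k) (fun y => (d k y).2) hek
    have h3 := average_outEnt_le (V := outKernel W (f k))
      (fun x b => Finset.sum_nonneg fun z _ => hW0 x z) hn (fun r => ∑ u, A r u) hA1
    have h4 := mul_le_mul_of_nonneg_left h2 (inv_nonneg.2 hn'.le)
    rw [Finset.sum_sub_distrib, mul_add, mul_sub] at h4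
    rw [mul_div_assoc', div_eq_inv_mul]
    linarith
  · have h2 := log_card_fst_le hW0 hW hM₁ hM₂ hc h0 h1 (f j) (f k) (hfg j hj)
      (fun y => (d j y).1) (hej j hj)
    have h4 := mul_le_mul_of_nonneg_left h2 (inv_nonneg.2 hn'.le)
    rw [Finset.sum_sub_distrib, mul_add, mul_sub] at h4
    have h5 : ∑ x, ((n : ℝ)⁻¹ • ∑ r, ∑ u, A r u) x * outEnt (outKernel W (f j)) (Pi.single x 1) =
        (n : ℝ)⁻¹ * ∑ r, ∑ x, (∑ u, A r u) x * outEnt (outKernel W (f j)) (Pi.single x 1) := by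
      conv_rhs => rw [Finset.sum_comm, Finset.mul_sum]
      refine Finset.sum_congr rfl fun x _ => ?_
      rw [Pi.smul_apply, Finset.sum_apply, smul_eq_mul, mul_assoc, Finset.sum_mul]
    rw [mul_div_assoc', div_eq_inv_mul, h5]
    linarith

omit [Fintype 𝒳] [DecidableEq 𝒳] in
theorem success_le_sum_blockLaw (hW0 : ∀ x z, 0 ≤ W x z) (enc : Fin M₁ → Fin M₂ → Fin n → 𝒳)
    (P : Fin M₁ → Fin M₂ → (Fin n → 𝒵) → Prop) [∀ m₁ m₂, DecidablePred (P m₁ m₂)]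
    (Q : (Fin M₁ × Fin M₂) × (Fin n → 𝒵) → Prop) [DecidablePred Q]
    (hPQ : ∀ m₁ m₂ y, P m₁ m₂ y → Q ((m₁, m₂), y)) :
    ((M₁ : ℝ) * M₂)⁻¹ * ∑ m₁, ∑ m₂, ∑ y ∈ univ.filter (P m₁ m₂), ∏ t, W (enc m₁ m₂ t) (y t) ≤
      ∑ ω ∈ univ.filter Q, blockLaw W (fun _ => ((M₁ : ℝ) * M₂)⁻¹) (fun m => enc m.1 m.2) ω := by
  simp only [Finset.sum_filter, Fintype.sum_prod_type, blockLaw, Finset.mul_sum]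
  refine Finset.sum_le_sum fun m₁ _ => Finset.sum_le_sum fun m₂ _ => Finset.sum_le_sum fun y _ => ?_
  have h0 : 0 ≤ ((M₁ : ℝ) * M₂)⁻¹ * ∏ t, W (enc m₁ m₂ t) (y t) :=
    mul_nonneg (by positivity) (Finset.prod_nonneg fun t _ => hW0 _ _)
  by_cases hP : P m₁ m₂ y
  · simp [hP, hPQ _ _ _ hP]
  · simp only [hP, if_false, mul_zero]
    split_ifs
    exacts [h0, le_rfl]

theorem tendsto_fanoSlack : Filter.Tendsto fanoSlack (nhds 0) (nhds 0) := by
  have h : ContinuousAt fanoSlack 0 := by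
    unfold fanoSlack
    refine Real.continuous_negMulLog.continuousAt.sub (ContinuousAt.log (by fun_prop) (by simp))
  simpa [ContinuousAt, fanoSlack] using h

omit [∀ i, DecidableEq (β i)] in
/-- Single-letter points satisfying the rate bounds up to vanishing slack accumulate at one that
satisfies them exactly. -/
theorem exists_mem_convexHull_of_approx [Fintype ι] (V : ∀ i, 𝒳 → β i → ℝ) (k : ι) (J : ι → Prop)
    (a₁ a₂ b : ℝ)
    (h : ∀ ε : ℝ, 0 < ε → ε < 1 → ∃ z ∈ convexHull ℝ (entropyGraph V),
      (1 - ε) * ((a₂ - ε) * b) ≤ outEnt (V k) z.1 - z.2 k + fanoSlack ε ∧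
      ∀ j, J j → (1 - ε) * ((a₁ - ε) * b) ≤
        z.2 j - ∑ x, z.1 x * outEnt (V j) (Pi.single x 1) + fanoSlack ε) :
    ∃ z ∈ convexHull ℝ (entropyGraph V), a₂ * b ≤ outEnt (V k) z.1 - z.2 k ∧
      ∀ j, J j → a₁ * b ≤ z.2 j - ∑ x, z.1 x * outEnt (V j) (Pi.single x 1) := by
  let ε : ℕ → ℝ := fun N => 1 / ((N + 1 : ℕ) + 1 : ℝ)
  have hε0 : ∀ N, 0 < ε N := fun N => by positivity
  have hε1 : ∀ N, ε N < 1 := fun N => by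
    simp only [ε]
    rw [div_lt_one (by positivity)]
    push_cast
    linarith [(Nat.cast_nonneg N : (0 : ℝ) ≤ N)]
  have hε : Filter.Tendsto ε Filter.atTop (nhds 0) :=
    tendsto_one_div_add_atTop_nhds_zero_nat.comp (Filter.tendsto_add_atTop_nat 1)
  choose z hz hz2 hz1 using fun N => h (ε N) (hε0 N) (hε1 N)
  obtain ⟨y, hy, φ, hφ, hlim⟩ :=
    (isCompact_convexHull_of_finiteDimensional (isCompact_entropyGraph V)).tendsto_subseq hz
  have hεφ := hε.comp hφ.tendsto_atTop
  have hslack := tendsto_fanoSlack.comp hεφ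
  have hleft : ∀ a : ℝ, Filter.Tendsto (fun N => (1 - ε (φ N)) * ((a - ε (φ N)) * b))
      Filter.atTop (nhds (a * b)) := fun a => by
    simpa using (hεφ.const_sub 1).mul ((hεφ.const_sub a).mul_const b)
  have hcont : ∀ F : (𝒳 → ℝ) × (ι → ℝ) → ℝ, Continuous F →
      Filter.Tendsto (fun N => F (z (φ N)) + fanoSlack (ε (φ N))) Filter.atTop (nhds (F y)) :=
    fun F hF => by simpa using ((hF.tendsto y).comp hlim).add hslack
  refine ⟨y, hy, ?_, fun j hj => ?_⟩
  · exact le_of_tendsto_of_tendsto' (hleft a₂)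
      (hcont (fun w => outEnt (V k) w.1 - w.2 k)
        (((continuous_outEnt (V k)).comp continuous_fst).sub (by fun_prop)))
      fun N => hz2 (φ N)
  · exact le_of_tendsto_of_tendsto' (hleft a₁)
      (hcont (fun w => w.2 j - ∑ x, w.1 x * outEnt (V j) (Pi.single x 1)) (by fun_prop))
      fun N => hz1 (φ N) j hj

/-- The less-noisy condition of `g` by `f` on auxiliary laws of total mass one extends to all
finite families of nonnegative functions. -/
theorem sum_outEnt_sub_le_of_lessNoisy {α γ : Type*} [Fintype α] [DecidableEq α] [Fintype γ]
    [DecidableEq γ] (hW : ∀ x, ∑ z, W x z = 1) (f : 𝒵 → α) (g : 𝒵 → γ)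
    (hln : ∀ (m : ℕ) (μ : Fin m → 𝒳 → ℝ), (∀ u x, 0 ≤ μ u x) → ∑ u, ∑ x, μ u x = 1 →
      mutInf (oneShotLaw W μ) (fun ω => ω.1) (fun ω => g ω.2.2) ≤
        mutInf (oneShotLaw W μ) (fun ω => ω.1) (fun ω => f ω.2.2))
    {σ : Type*} [Fintype σ] (ν : σ → 𝒳 → ℝ) (hν : ∀ s x, 0 ≤ ν s x) :
    ∑ s, (outEnt (outKernel W f) (ν s) - outEnt (outKernel W g) (ν s)) ≤
      outEnt (outKernel W f) (∑ s, ν s) - outEnt (outKernel W g) (∑ s, ν s) := by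
  have hlog : 0 < Real.log 2 := Real.log_pos one_lt_two
  refine sum_le_of_homogeneous
    (D := fun q => outEnt (outKernel W f) q - outEnt (outKernel W g) q) (fun a q => ?_)
    (fun m μ h0 h1 => ?_) ν hν
  · simp only [outEnt_smul fun x => (sum_outKernel W _ x).trans (hW x)]
    ring
  · have h2 := hln m μ h0 h1
    rw [mutInf_oneShotLaw hW h1, mutInf_oneShotLaw hW h1,
      div_le_div_iff_of_pos_right hlog] at h2
    rw [Finset.sum_sub_distrib]
    linarith

theorem sub_mul_log_two_le {R ε : ℝ} (h : R - ε ≤ Real.logb 2 M₁ / n) :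
    (R - ε) * Real.log 2 ≤ Real.log M₁ / n := by
  have hlog : 0 < Real.log 2 := Real.log_pos one_lt_two
  refine (mul_le_mul_of_nonneg_right h hlog.le).trans_eq ?_
  rw [Real.logb]
  field_simp

end Converse

/-- Converse for the `K`-receiver DM BC with messages
`M_{\bar K}` (rate `R1`, desired by receivers `1..K-1`, i.e. 0-indexed `0,…,K-2`)
and `M_{\bar{K-1}}` (rate `R2`, desired by receivers `1..K-2` and `K`, i.e. all
0-indexed receivers except `⟨K-2,_⟩`), for the class of channels in which `Y_i`
is less noisy than `Y_K` for every `i ∈ [1:K-1]`: every achievable rate pair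
satisfies, for some auxiliary distribution `p(u,x)` (an alphabet `Fin m` and a
joint pmf `μ`, the channel outputs generated via the one-shot channel `Wch`),
`R2 ≤ I(U;Y_K)` and `R2 + R1 ≤ I(X;Y_j | U) + I(U;Y_K)` for all `j ∈ [1:K-1]`. -/
theorem stmt_18 (K : ℕ) (hK : 2 ≤ K)
    (𝒳 : Type) [Fintype 𝒳] [DecidableEq 𝒳]
    (𝒴 : Fin K → Type) [∀ i, Fintype (𝒴 i)] [∀ i, DecidableEq (𝒴 i)]
    (Wch : 𝒳 → (∀ i, 𝒴 i) → ℝ)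
    (hW0 : ∀ x y, 0 ≤ Wch x y) (hW1 : ∀ x, ∑ y : ∀ i, 𝒴 i, Wch x y = 1)
    -- `Y_i` is less noisy than `Y_K` for every `i ∈ [1:K-1]`:
    (hln : ∀ i : Fin K, (i : ℕ) < K - 1 →
      ∀ (m : ℕ) (μ : Fin m → 𝒳 → ℝ),
        (∀ u x, 0 ≤ μ u x) → (∑ u : Fin m, ∑ x : 𝒳, μ u x = 1) →
        mutInf (fun ω : Fin m × 𝒳 × (∀ i, 𝒴 i) => μ ω.1 ω.2.1 * Wch ω.2.1 ω.2.2)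
            (fun ω => ω.1) (fun ω => ω.2.2 (⟨K - 1, by omega⟩ : Fin K)) ≤
          mutInf (fun ω : Fin m × 𝒳 × (∀ i, 𝒴 i) => μ ω.1 ω.2.1 * Wch ω.2.1 ω.2.2)
            (fun ω => ω.1) (fun ω => ω.2.2 i))
    (R1 R2 : ℝ)
    -- achievability of `(R1, R2)` over the memoryless broadcast channel:
    (hach : ∀ ε : ℝ, 0 < ε → ∃ (n M1 M2 : ℕ), 0 < n ∧ 0 < M1 ∧ 0 < M2 ∧
      R1 - ε ≤ Real.logb 2 M1 / n ∧ R2 - ε ≤ Real.logb 2 M2 / n ∧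
      ∃ (enc : Fin M1 → Fin M2 → Fin n → 𝒳)
        (dec : ∀ i : Fin K, (Fin n → 𝒴 i) → Fin M1 × Fin M2),
        1 - ((M1 : ℝ) * M2)⁻¹ *
            ∑ m1 : Fin M1, ∑ m2 : Fin M2,
              ∑ y ∈ univ.filter (fun y : Fin n → ∀ i, 𝒴 i =>
                  (∀ i : Fin K, (i : ℕ) < K - 1 → (dec i (fun t => y t i)).1 = m1) ∧
                  (∀ i : Fin K, (i : ℕ) ≠ K - 2 → (dec i (fun t => y t i)).2 = m2)),
                ∏ t, Wch (enc m1 m2 t) (y t) ≤ ε) :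
    ∃ (m : ℕ) (μ : Fin m → 𝒳 → ℝ),
      (∀ u x, 0 ≤ μ u x) ∧ (∑ u : Fin m, ∑ x : 𝒳, μ u x = 1) ∧
      R2 ≤ mutInf (fun ω : Fin m × 𝒳 × (∀ i, 𝒴 i) => μ ω.1 ω.2.1 * Wch ω.2.1 ω.2.2)
          (fun ω => ω.1) (fun ω => ω.2.2 (⟨K - 1, by omega⟩ : Fin K)) ∧
      ∀ j : Fin K, (j : ℕ) < K - 1 →
        R2 + R1 ≤
          condMutInf (fun ω : Fin m × 𝒳 × (∀ i, 𝒴 i) => μ ω.1 ω.2.1 * Wch ω.2.1 ω.2.2)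
            (fun ω => ω.2.1) (fun ω => ω.2.2 j) (fun ω => ω.1) +
          mutInf (β := 𝒴 (⟨K - 1, by omega⟩ : Fin K))
            (fun ω : Fin m × 𝒳 × (∀ i, 𝒴 i) => μ ω.1 ω.2.1 * Wch ω.2.1 ω.2.2)
            (fun ω => ω.1) (fun ω => ω.2.2 (⟨K - 1, by omega⟩ : Fin K)) := by
  set k : Fin K := ⟨K - 1, by omega⟩ with hk
  have hlog : 0 < Real.log 2 := Real.log_pos one_lt_two
  let f : ∀ i, (∀ i, 𝒴 i) → 𝒴 i := fun i y => y i
  obtain ⟨z, hz, hz2, hz1⟩ := exists_mem_convexHull_of_approx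
    (fun i => outKernel Wch (f i)) k (fun j => (j : ℕ) < K - 1) R1 R2 (Real.log 2)
    (fun ε h0 h1 => by
      obtain ⟨n, M1, M2, hn, hM1, hM2, hR1, hR2, enc, dec, herr⟩ := hach ε h0
      have hsucc := sub_le_comm.1 herr
      obtain ⟨z, hz, hz2, hz1⟩ := exists_mem_convexHull_of_block f k
        (fun j => (j : ℕ) < K - 1) hW0 hW1 hn hM1 hM2 (fun _ => rfl) h0 h1
        (fun j hj ν hν => sum_outEnt_sub_le_of_lessNoisy hW1 (f j) (f k) (hln j hj) ν hν)
        dec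
        (hsucc.trans (success_le_sum_blockLaw hW0 enc _ _ fun m₁ m₂ y hy =>
          hy.2 k (by simp only [hk]; omega)))
        (fun j hj => hsucc.trans (success_le_sum_blockLaw hW0 enc _ _ fun m₁ m₂ y hy =>
          hy.1 j hj))
      exact ⟨z, hz, (mul_le_mul_of_nonneg_left (sub_mul_log_two_le hR2)
          (sub_nonneg.2 h1.le)).trans hz2,
        fun j hj => (mul_le_mul_of_nonneg_left (sub_mul_log_two_le hR1)
          (sub_nonneg.2 h1.le)).trans (hz1 j hj)⟩)
  obtain ⟨m, μ, hμ0, hμ1, hμ, hent⟩ := exists_fin_of_mem_convexHull_entropyGraph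
    (fun i x => (sum_outKernel Wch (f i) x).trans (hW1 x)) hz
  have hI := mutInf_oneShotLaw hW1 hμ1 (f k)
  have hC := fun j => condMutInf_oneShotLaw (μ := μ) hW1 (f j)
  simp only [hμ, hent] at hI hC
  have hR2 : R2 ≤ mutInf (oneShotLaw Wch μ) (fun ω => ω.1) (fun ω => f k ω.2.2) := by
    rw [hI, le_div_iff₀ hlog]
    exact hz2
  refine ⟨m, μ, hμ0, hμ1, hR2, fun j hj => (add_comm R2 R1).trans_le (add_le_add ?_ hR2)⟩
  refine le_of_le_of_eq ?_ (hC j).symm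
  rw [le_div_iff₀ hlog]
  exact hz1 j hj
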